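/- Expected purity of the comb subsystem: let k ≥ 2 divide n and let A := {k, 2k, …, n} be the set consisting of every k-th site. Then the unnormalized reduced state of a random matrix product state satisfies E_{ψ ∼ μ_{d,n,D}} Tr[ρ_A²] ≤ ( η(d,D)^{k−1} + η(D,d) + η(d,D) )^{n/k}. -/

import Mathlib

open MeasureTheory Matrix
open scoped ComplexConjugate

noncomputable section

instance matrixMeasurableSpace {m n : Type*} : MeasurableSpace (Matrix m n ℂ) :=
  MeasurableSpace.pi

/-- The site tensor `A^{(m)}_i = (⟨i| ⊗ 1_D) U (|0⟩ ⊗ 1_D)`. -/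
def siteMat (d D : ℕ) [NeZero d] (U : Matrix.unitaryGroup (Fin d × Fin D) ℂ) (i : Fin d) :
    Matrix (Fin D) (Fin D) ℂ :=
  Matrix.of fun a b => (U : Matrix (Fin d × Fin D) (Fin d × Fin D) ℂ) (i, a) (0, b)

/-- The (unnormalized) matrix product state `ψ`, with periodic boundary conditions:
`ψ(i₁,…,iₙ) = Tr[A^{(1)}_{i₁} ⋯ A^{(n)}_{iₙ}]`. -/
def mps (d D n : ℕ) [NeZero d] (U : Fin n → Matrix.unitaryGroup (Fin d × Fin D) ℂ) :
    (Fin n → Fin d) → ℂ :=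
  fun idx => Matrix.trace (((List.finRange n).map fun m => siteMat d D (U m) (idx m)).prod)
open scoped ComplexOrder

/-- Merge a configuration on `A` with a configuration on `Aᶜ` into a full configuration. -/
def mergeCfg {n d : ℕ} (A : Finset (Fin n)) (x : (i : A) → Fin d)
    (z : (i : (Aᶜ : Finset (Fin n))) → Fin d) : Fin n → Fin d :=
  fun i => if h : i ∈ A then x ⟨i, h⟩ else z ⟨i, Finset.mem_compl.mpr h⟩

/-- The (unnormalized) reduced density matrix `ρ_A = Tr_{A^c}[|ψ⟩⟨ψ|]` of a vector
`ψ ∈ (ℂ^d)^{⊗n}` on the sites in `A`. -/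
def rhoA {n d : ℕ} (A : Finset (Fin n)) (ψ : (Fin n → Fin d) → ℂ) :
    Matrix ((i : A) → Fin d) ((i : A) → Fin d) ℂ :=
  Matrix.of fun x y =>
    ∑ z : (i : (Aᶜ : Finset (Fin n))) → Fin d, ψ (mergeCfg A x z) * conj (ψ (mergeCfg A y z))

/-- `η(x,y) := (x y² − x)/(x² y² − 1)`. -/
def etaF (x y : ℝ) : ℝ := (x * y ^ 2 - x) / (x ^ 2 * y ^ 2 - 1)

section
variable {ι : Type*} [Fintype ι] [DecidableEq ι]

def FF (μ : Measure (Matrix.unitaryGroup ι ℂ)) (c1 c2 c3 c4 r1 r2 r3 r4 : ι) : ℂ :=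
  ∫ U, U.1 r1 c1 * U.1 r2 c2 * conj (U.1 r3 c3) * conj (U.1 r4 c4) ∂μ

theorem meas_entry (r c : ι) : Measurable fun U : Matrix.unitaryGroup ι ℂ => U.1 r c := by
  have h1 : Measurable fun M : Matrix ι ι ℂ => M r c :=
    (measurable_pi_apply c).comp (measurable_pi_apply r)
  exact h1.comp measurable_subtype_coe

theorem meas_conj_entry (r c : ι) :
    Measurable fun U : Matrix.unitaryGroup ι ℂ => conj (U.1 r c) :=
  (Complex.continuous_conj.measurable).comp (meas_entry r c)

theorem meas_mono (c1 c2 c3 c4 r1 r2 r3 r4 : ι) :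
    Measurable fun U : Matrix.unitaryGroup ι ℂ =>
      U.1 r1 c1 * U.1 r2 c2 * conj (U.1 r3 c3) * conj (U.1 r4 c4) :=
  (((meas_entry _ _).mul (meas_entry _ _)).mul (meas_conj_entry _ _)).mul (meas_conj_entry _ _)

theorem meas_mul (V : Matrix.unitaryGroup ι ℂ) :
    Measurable fun U : Matrix.unitaryGroup ι ℂ => V * U := by
  refine Measurable.subtype_mk (f := fun U : Matrix.unitaryGroup ι ℂ => V.1 * U.1) ?_
  refine measurable_pi_lambda _ fun r => measurable_pi_lambda _ fun c => ?_
  simp only [Matrix.mul_apply]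
  exact Finset.measurable_sum _ fun j _ => (meas_entry j c).const_mul _

theorem integrable_mono (μ : Measure (Matrix.unitaryGroup ι ℂ)) [IsProbabilityMeasure μ]
    (c1 c2 c3 c4 r1 r2 r3 r4 : ι) :
    Integrable (fun U : Matrix.unitaryGroup ι ℂ =>
      U.1 r1 c1 * U.1 r2 c2 * conj (U.1 r3 c3) * conj (U.1 r4 c4)) μ := by
  refine Integrable.of_bound (meas_mono _ _ _ _ _ _ _ _).aestronglyMeasurable 1 ?_
  refine Filter.Eventually.of_forall fun U => ?_
  have h := fun r c => entry_norm_bound_of_unitary U.2 r c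
  simp only [norm_mul, RCLike.norm_conj]
  have h1 := h r1 c1
  have h2 := h r2 c2
  have h3 := h r3 c3
  have h4 := h r4 c4
  exact mul_le_one₀ (mul_le_one₀ (mul_le_one₀ h1 (norm_nonneg _) h2) (norm_nonneg _) h3) (norm_nonneg _) h4

variable (μ : Measure (Matrix.unitaryGroup ι ℂ)) [IsProbabilityMeasure μ]
  (hH : ∀ V : Matrix.unitaryGroup ι ℂ, μ.map (fun U => V * U) = μ)

include hH in
theorem FF_inv (V : Matrix.unitaryGroup ι ℂ) (c1 c2 c3 c4 r1 r2 r3 r4 : ι) :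
    FF μ c1 c2 c3 c4 r1 r2 r3 r4 = ∑ s1, ∑ s2, ∑ s3, ∑ s4,
      V.1 r1 s1 * V.1 r2 s2 * conj (V.1 r3 s3) * conj (V.1 r4 s4) *
        FF μ c1 c2 c3 c4 s1 s2 s3 s4 := by
  conv_lhs => rw [FF, ← hH V]
  rw [integral_map (meas_mul V).aemeasurable (meas_mono _ _ _ _ _ _ _ _).aestronglyMeasurable]
  have key : ∀ U : Matrix.unitaryGroup ι ℂ,
      (V * U).1 r1 c1 * (V * U).1 r2 c2 * conj ((V * U).1 r3 c3) * conj ((V * U).1 r4 c4) =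
      ∑ s1, ∑ s2, ∑ s3, ∑ s4, V.1 r1 s1 * V.1 r2 s2 * conj (V.1 r3 s3) * conj (V.1 r4 s4) *
        (U.1 s1 c1 * U.1 s2 c2 * conj (U.1 s3 c3) * conj (U.1 s4 c4)) := by
    intro U
    have : ∀ r c, (V * U).1 r c = ∑ s, V.1 r s * U.1 s c := fun r c => Matrix.mul_apply
    simp only [this, map_sum, map_mul]
    simp only [mul_assoc, Finset.sum_mul]
    simp only [Finset.mul_sum]
    refine Finset.sum_congr rfl fun _ _ => Finset.sum_congr rfl fun _ _ =>
      Finset.sum_congr rfl fun _ _ => Finset.sum_congr rfl fun _ _ => by ring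
  simp only [key]
  have hi := integrable_mono μ c1 c2 c3 c4
  rw [integral_finsetSum _ fun _ _ => integrable_finsetSum _ fun _ _ =>
    integrable_finsetSum _ fun _ _ => integrable_finsetSum _ fun _ _ => (hi _ _ _ _).const_mul _]
  refine Finset.sum_congr rfl fun _ _ => ?_
  rw [integral_finsetSum _ fun _ _ =>
    integrable_finsetSum _ fun _ _ => integrable_finsetSum _ fun _ _ => (hi _ _ _ _).const_mul _]
  refine Finset.sum_congr rfl fun _ _ => ?_
  rw [integral_finsetSum _ fun _ _ => integrable_finsetSum _ fun _ _ => (hi _ _ _ _).const_mul _]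
  refine Finset.sum_congr rfl fun _ _ => ?_
  rw [integral_finsetSum _ fun _ _ => (hi _ _ _ _).const_mul _]
  refine Finset.sum_congr rfl fun _ _ => ?_
  rw [integral_const_mul, FF]

include hH in
theorem FF_diag (v : ι → ℂ) (hv : ∀ i, v i * conj (v i) = 1) (c1 c2 c3 c4 r1 r2 r3 r4 : ι) :
    FF μ c1 c2 c3 c4 r1 r2 r3 r4 =
      v r1 * v r2 * conj (v r3) * conj (v r4) * FF μ c1 c2 c3 c4 r1 r2 r3 r4 := by
  have hV : Matrix.diagonal v ∈ Matrix.unitaryGroup ι ℂ := by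
    rw [Matrix.mem_unitaryGroup_iff, Matrix.star_eq_conjTranspose, Matrix.diagonal_conjTranspose,
      Matrix.diagonal_mul_diagonal, ← Matrix.diagonal_one]
    congr 1; funext i; exact hv i
  conv_lhs => rw [FF_inv μ hH ⟨_, hV⟩]
  simp [Matrix.diagonal_apply, apply_ite, ite_mul, mul_ite]

include hH in
theorem FF_perm (σ : Equiv.Perm ι) (c1 c2 c3 c4 r1 r2 r3 r4 : ι) :
    FF μ c1 c2 c3 c4 r1 r2 r3 r4 = FF μ c1 c2 c3 c4 (σ r1) (σ r2) (σ r3) (σ r4) := by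
  have hV : σ.permMatrix ℂ ∈ Matrix.unitaryGroup ι ℂ := by
    rw [Matrix.mem_unitaryGroup_iff, Matrix.star_eq_conjTranspose]
    ext i j
    have : ∀ a b, σ.permMatrix ℂ a b = if b = σ a then 1 else 0 := by
      intro a b; simp [Equiv.Perm.permMatrix, PEquiv.toMatrix_apply, eq_comm]
    simp only [Matrix.mul_apply, Matrix.conjTranspose_apply, this, Matrix.one_apply, ite_mul, one_mul,
      zero_mul, Finset.sum_ite_eq', Finset.mem_univ, if_true]
    by_cases h : i = j <;> simp [h]
  conv_lhs => rw [FF_inv μ hH ⟨_, hV⟩]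
  simp [Equiv.Perm.permMatrix, PEquiv.toMatrix_apply, apply_ite, ite_mul, mul_ite]

include hH in
theorem FF_zero (c1 c2 c3 c4 r1 r2 r3 r4 : ι)
    (h : ¬ ((r1 = r3 ∧ r2 = r4) ∨ (r1 = r4 ∧ r2 = r3))) :
    FF μ c1 c2 c3 c4 r1 r2 r3 r4 = 0 := by
  have key : ∀ x, FF μ c1 c2 c3 c4 r1 r2 r3 r4 = 0 ∨ 
      (if r1 = x then Complex.I else 1) * (if r2 = x then Complex.I else 1)
       * conj (if r3 = x then Complex.I else 1) * conj (if r4 = x then Complex.I else 1) = 1 := by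
    intro x
    have := FF_diag μ hH (fun i => if i = x then Complex.I else 1)
      (by intro i; by_cases hi : i = x <;> simp [hi]) c1 c2 c3 c4 r1 r2 r3 r4
    by_cases h0 : FF μ c1 c2 c3 c4 r1 r2 r3 r4 = 0
    · exact Or.inl h0
    · right
      exact mul_right_cancel₀ h0 (by rw [one_mul]; exact this.symm)
  have h1 := key r1
  have h2 := key r2
  have e1 : (Complex.I : ℂ) ≠ 1 := by intro h; simpa using congrArg Complex.re h
  have e2 : (-1 : ℂ) ≠ 1 := by norm_num
  have e3 : (-Complex.I : ℂ) ≠ 1 := by intro h; simpa using congrArg Complex.re h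
  rcases h1 with h1 | h1
  · exact h1
  rcases h2 with h2 | h2
  · exact h2
  exfalso
  by_cases a : r1 = r2 <;> by_cases b : r1 = r3 <;> by_cases c : r1 = r4 <;>
  by_cases a' : r2 = r3 <;> by_cases b' : r2 = r4 <;> by_cases c' : r3 = r4 <;>
  simp_all [eq_comm]

theorem refl_unitary (x y : ι) (hxy : x ≠ y) : 
   (1 - Matrix.of fun i j => (2/5 : ℂ) * ((Pi.single x 1 + Pi.single y 2 : ι → ℂ) i) *
      ((Pi.single x 1 + Pi.single y 2 : ι → ℂ) j)) ∈ Matrix.unitaryGroup ι ℂ := by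
  rw [Matrix.mem_unitaryGroup_iff, Matrix.star_eq_conjTranspose]
  set v : ι → ℂ := Pi.single x 1 + Pi.single y 2 with hv
  have hc : ∀ i, conj (v i) = v i := by
    intro i
    simp only [hv, Pi.add_apply, Pi.single_apply]
    split_ifs <;> simp [Complex.conj_ofNat]
  have hs : ∑ i, v i * v i = 5 := by
    simp only [hv, Pi.add_apply, Pi.single_apply, mul_add, add_mul, Finset.sum_add_distrib]
    simp [hxy, hxy.symm]
    norm_num
  have hW : (Matrix.of fun i j => (2/5 : ℂ) * v i * v j)ᴴ = Matrix.of fun i j => (2/5 : ℂ) * v i * v j := by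
    ext i j
    simp only [Matrix.conjTranspose_apply, Matrix.of_apply, star_mul']
    have h1 : star (v i) = v i := hc i
    have h2 : star (v j) = v j := hc j
    have h3 : star (2/5 : ℂ) = 2/5 := by
      change conj (2/5 : ℂ) = 2/5
      rw [map_div₀, Complex.conj_ofNat, Complex.conj_ofNat]
    rw [h1, h2, h3]; ring
  have hWW : (Matrix.of fun i j => (2/5 : ℂ) * v i * v j) * (Matrix.of fun i j => (2/5 : ℂ) * v i * v j)
      = (2:ℂ) • Matrix.of fun i j => (2/5 : ℂ) * v i * v j := by
    ext i j
    simp only [Matrix.mul_apply, Matrix.of_apply, Matrix.smul_apply, smul_eq_mul]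
    calc _ = (4/25) * v i * v j * ∑ k, v k * v k := by
          rw [Finset.mul_sum]; exact Finset.sum_congr rfl fun _ _ => by ring
      _ = _ := by rw [hs]; ring
  rw [Matrix.conjTranspose_sub, hW, Matrix.conjTranspose_one, sub_mul, mul_sub, mul_sub, hWW]
  simp only [one_mul, mul_one, two_smul]
  abel

include hH in
theorem FF_rel (x y : ι) (hxy : x ≠ y) (c1 c2 c3 c4 : ι) :
    FF μ c1 c2 c3 c4 x x x x = FF μ c1 c2 c3 c4 x y x y + FF μ c1 c2 c3 c4 x y y x := by
  have h := FF_inv μ hH ⟨_, refl_unitary x y hxy⟩ c1 c2 c3 c4 x y x y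
  have hx : ∀ s, (1 - Matrix.of fun i j => (2/5 : ℂ) * ((Pi.single x 1 + Pi.single y 2 : ι → ℂ) i) *
      ((Pi.single x 1 + Pi.single y 2 : ι → ℂ) j)) x s = 
      (if s = x then (3/5:ℂ) else 0) + (if s = y then (-4/5:ℂ) else 0) := by
    intro s
    by_cases h1 : s = x
    · subst h1; simp [hxy]; norm_num
    · by_cases h2 : s = y
      · subst h2; simp [hxy, h1]; norm_num
      · simp [h1, h2, hxy, Matrix.one_apply, Ne.symm h1]
  have hy : ∀ s, (1 - Matrix.of fun i j => (2/5 : ℂ) * ((Pi.single x 1 + Pi.single y 2 : ι → ℂ) i) *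
      ((Pi.single x 1 + Pi.single y 2 : ι → ℂ) j)) y s = 
      (if s = x then (-4/5:ℂ) else 0) + (if s = y then (-3/5:ℂ) else 0) := by
    intro s
    by_cases h1 : s = x
    · subst h1; simp [hxy, hxy.symm]; norm_num
    · by_cases h2 : s = y
      · subst h2; simp [hxy, hxy.symm, h1]; norm_num
      · simp [h1, h2, hxy, hxy.symm, Matrix.one_apply, Ne.symm h2]
  simp only [hx, hy, map_add, apply_ite conj, map_zero, mul_add, add_mul, Finset.sum_add_distrib, ite_mul, mul_ite, zero_mul, mul_zero, Finset.sum_ite_eq', Finset.mem_univ, if_true, Finset.sum_const_zero] at h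
  have z := FF_zero μ hH c1 c2 c3 c4
  have hyx := hxy.symm
  have p := FF_perm μ hH (Equiv.swap x y) c1 c2 c3 c4
  have p1 := p x x x x
  have p2 := p x y x y
  have p3 := p x y y x
  simp only [Equiv.swap_apply_left, Equiv.swap_apply_right] at p1 p2 p3
  rw [z x x x y (by simp [hxy]), z x x y x (by simp [hxy]), z x x y y (by simp [hxy]),
    z x y x x (by simp [hyx]), z x y y y (by simp [hxy]), z y x x x (by simp [hyx]),
    z y x y y (by simp [hxy]), z y y x x (by simp [hyx]), z y y x y (by simp [hyx]),
    z y y y x (by simp [hyx]), ← p1, ← p2, ← p3] at h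
  simp only [map_div₀, map_neg, map_ofNat] at h
  linear_combination (-625/288) * h

include hH in
theorem FF_form (hc : 2 ≤ Fintype.card ι) (c1 c2 c3 c4 : ι) : ∃ α β : ℂ, ∀ r1 r2 r3 r4,
    FF μ c1 c2 c3 c4 r1 r2 r3 r4 = α * (if r1 = r3 ∧ r2 = r4 then 1 else 0)
      + β * (if r1 = r4 ∧ r2 = r3 then 1 else 0) := by
  obtain ⟨x, y, hxy⟩ := Fintype.exists_pair_of_one_lt_card (α := ι) (by omega)
  have two : ∀ a b, a ≠ b → ∃ σ : Equiv.Perm ι, σ a = x ∧ σ b = y := by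
    intro a b hab
    refine ⟨(Equiv.swap a x).trans (Equiv.swap ((Equiv.swap a x) b) y), ?_, by simp⟩
    simp only [Equiv.trans_apply, Equiv.swap_apply_left]
    refine Equiv.swap_apply_of_ne_of_ne ?_ hxy
    intro h
    apply hab
    apply (Equiv.swap a x).injective
    rw [← h]; simp
  refine ⟨FF μ c1 c2 c3 c4 x y x y, FF μ c1 c2 c3 c4 x y y x, fun r1 r2 r3 r4 => ?_⟩
  by_cases h : (r1 = r3 ∧ r2 = r4) ∨ (r1 = r4 ∧ r2 = r3)
  · by_cases h12 : r1 = r2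
    · subst h12
      have : r3 = r1 ∧ r4 = r1 := by rcases h with ⟨h, h'⟩ | ⟨h, h'⟩ <;> exact ⟨by simp_all, by simp_all⟩
      obtain ⟨e1, e2⟩ := this
      subst e1 e2
      rw [FF_perm μ hH (Equiv.swap _ x), Equiv.swap_apply_left]
      simp [FF_rel μ hH x y hxy]
    · obtain ⟨σ, h1, h2⟩ := two r1 r2 h12
      rw [FF_perm μ hH σ]
      rcases h with ⟨rfl, rfl⟩ | ⟨rfl, rfl⟩
      · simp [h1, h2, h12]
      · simp [h1, h2, Ne.symm h12, h12]
  · rw [FF_zero μ hH _ _ _ _ _ _ _ _ h]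
    push Not at h
    rw [if_neg (by tauto), if_neg (by tauto)]
    simp

theorem unit_col (U : Matrix.unitaryGroup ι ℂ) (c c' : ι) :
    ∑ r, U.1 r c * conj (U.1 r c') = if c = c' then 1 else 0 := by
  have h := congrFun (congrFun (Matrix.mem_unitaryGroup_iff'.1 U.2) c') c
  simp only [Matrix.star_eq_conjTranspose, Matrix.mul_apply, Matrix.conjTranspose_apply, Matrix.one_apply] at h
  rw [show (if c = c' then (1:ℂ) else 0) = if c' = c then 1 else 0 by simp [eq_comm], ← h]
  exact Finset.sum_congr rfl fun _ _ => mul_comm _ _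

theorem FF_tr1 (c1 c2 c3 c4 : ι) : ∑ r1, ∑ r2, FF μ c1 c2 c3 c4 r1 r2 r1 r2 =
    (if c1 = c3 ∧ c2 = c4 then 1 else 0) := by
  have hi := integrable_mono μ c1 c2 c3 c4
  simp only [FF]
  simp_rw [← integral_finsetSum _ fun _ _ => hi _ _ _ _]
  rw [← integral_finsetSum _ fun _ _ => integrable_finsetSum _ fun _ _ => hi _ _ _ _]
  have : ∀ U : Matrix.unitaryGroup ι ℂ, ∑ r1, ∑ r2,
     U.1 r1 c1 * U.1 r2 c2 * conj (U.1 r1 c3) * conj (U.1 r2 c4) = 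
     (if c1 = c3 ∧ c2 = c4 then 1 else 0) := by
    intro U
    calc _ = (∑ r, U.1 r c1 * conj (U.1 r c3)) * ∑ r, U.1 r c2 * conj (U.1 r c4) := by
          rw [Finset.sum_mul_sum]
          exact Finset.sum_congr rfl fun _ _ => Finset.sum_congr rfl fun _ _ => by ring
      _ = _ := by rw [unit_col, unit_col]; by_cases h : c1 = c3 <;> by_cases h' : c2 = c4 <;> simp [h, h']
  simp [this]

theorem FF_swap (c1 c2 c3 c4 r1 r2 r3 r4 : ι) :
    FF μ c1 c2 c3 c4 r1 r2 r3 r4 = FF μ c1 c2 c4 c3 r1 r2 r4 r3 := by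
  simp only [FF]
  exact integral_congr_ae (Filter.Eventually.of_forall fun U => by ring)

include hH in
theorem FF_wg (hc : 2 ≤ Fintype.card ι) (c1 c2 c3 c4 r1 r2 r3 r4 : ι) :
    ((Fintype.card ι : ℂ)^2 - 1) * Fintype.card ι * FF μ c1 c2 c3 c4 r1 r2 r3 r4 =
    (Fintype.card ι * (if c1 = c3 ∧ c2 = c4 then 1 else 0) - (if c1 = c4 ∧ c2 = c3 then 1 else 0))
       * (if r1 = r3 ∧ r2 = r4 then 1 else 0)
      + (Fintype.card ι * (if c1 = c4 ∧ c2 = c3 then 1 else 0) - (if c1 = c3 ∧ c2 = c4 then 1 else 0))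
       * (if r1 = r4 ∧ r2 = r3 then 1 else 0) := by
  obtain ⟨α, β, h⟩ := FF_form μ hH hc c1 c2 c3 c4
  have t1 := FF_tr1 μ c1 c2 c3 c4
  have t2 := FF_tr1 μ c1 c2 c4 c3
  simp only [FF_swap μ c1 c2 c4 c3] at t2
  have i1 : ∀ a b : ι, (if a = b ∧ b = a then (1:ℂ) else 0) = if a = b then 1 else 0 := by
    intro a b; by_cases h : a = b <;> simp [h]
  simp only [h, and_self, if_true, i1, Finset.sum_add_distrib, ← Finset.mul_sum] at t1 t2
  simp at t1 t2
  rw [h, ← t1, ← t2]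
  ring
end
section
open Kronecker

theorem path_exists {κ : Type} [Fintype κ] [DecidableEq κ] (n : ℕ) : ∀ i j : κ,
    ∃ (P : Type) (_ : Fintype P) (p q : P → Fin n → κ), ∀ M : Fin n → Matrix κ κ ℂ,
      ((List.finRange n).map M).prod i j = ∑ t, ∏ m, M m (p t m) (q t m) := by
  induction n with
  | zero =>
    intro i j
    refine ⟨{_u : Unit // i = j}, inferInstance, fun _ m => m.elim0, fun _ m => m.elim0, fun M => ?_⟩
    by_cases h : i = j <;> simp [h, Matrix.one_apply]
  | succ n ih =>
    intro i j
    choose P hP p q h using fun k => ih k j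
    refine ⟨Σ k, P k, inferInstance, fun t => Fin.cons i (p t.1 t.2),
      fun t => Fin.cons t.1 (q t.1 t.2), fun M => ?_⟩
    rw [List.finRange_succ, List.map_cons, List.prod_cons, List.map_map, Matrix.mul_apply,
      Fintype.sum_sigma]
    refine Finset.sum_congr rfl fun k _ => ?_
    rw [show (M ∘ Fin.succ) = fun m => M m.succ from rfl, h k (fun m => M m.succ), Finset.mul_sum]
    refine Finset.sum_congr rfl fun t _ => ?_
    rw [Fin.prod_univ_succ]
    simp

theorem sum_prod_list {κ : Type} [Fintype κ] [DecidableEq κ] {S : Type} [Fintype S] [DecidableEq S]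
    (n : ℕ) (M : Fin n → S → Matrix κ κ ℂ) :
    ∑ s : Fin n → S, ((List.finRange n).map fun m => M m (s m)).prod =
      ((List.finRange n).map fun m => ∑ s, M m s).prod := by
  ext i j
  obtain ⟨P, hP, p, q, h⟩ := path_exists (κ := κ) n i j
  rw [Matrix.sum_apply, h]
  simp_rw [h]
  rw [Finset.sum_comm]
  refine Finset.sum_congr rfl fun t _ => ?_
  simp_rw [Matrix.sum_apply]
  rw [Finset.prod_univ_sum]
  simp

theorem int_prod_list {κ : Type} [Fintype κ] [DecidableEq κ] {Ω : Type} [MeasurableSpace Ω]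
    (μ : Measure Ω) [IsProbabilityMeasure μ]
    (n : ℕ) (M : Fin n → Ω → Matrix κ κ ℂ) (hM : ∀ m i j, Integrable (fun u => M m u i j) μ) :
    ∫ U, (((List.finRange n).map fun m => M m (U m)).prod).trace ∂(Measure.pi fun _ : Fin n => μ) =
      (((List.finRange n).map fun m => Matrix.of fun i j => ∫ u, M m u i j ∂μ).prod).trace := by
  have key : ∀ i j, Integrable (fun U : Fin n → Ω => ((List.finRange n).map fun m => M m (U m)).prod i j)
      (Measure.pi fun _ : Fin n => μ) ∧
      ∫ U, ((List.finRange n).map fun m => M m (U m)).prod i j ∂(Measure.pi fun _ : Fin n => μ) =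
      ((List.finRange n).map fun m => Matrix.of fun i j => ∫ u, M m u i j ∂μ).prod i j := by
    intro i j
    obtain ⟨P, hP, p, q, h⟩ := path_exists (κ := κ) n i j
    have hi : ∀ t, Integrable (fun U : Fin n → Ω => ∏ m, M m (U m) (p t m) (q t m))
      (Measure.pi fun _ : Fin n => μ) := fun t =>
      Integrable.fintype_prod (f := fun m u => M m u (p t m) (q t m)) fun m => hM _ _ _
    simp_rw [h]
    refine ⟨integrable_finsetSum _ fun t _ => hi t, ?_⟩
    rw [integral_finsetSum _ fun t _ => hi t]
    refine Finset.sum_congr rfl fun t _ => ?_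
    rw [integral_fintype_prod_eq_prod (fun m u => M m u (p t m) (q t m))]
    rfl
  simp only [Matrix.trace, Matrix.diag_apply]
  rw [integral_finsetSum _ fun i _ => (key i i).1]
  exact Finset.sum_congr rfl fun i _ => (key i i).2

theorem kron_list {α κ κ' : Type} [Fintype κ] [DecidableEq κ] [Fintype κ'] [DecidableEq κ']
    (l : List α) (f : α → Matrix κ κ ℂ) (g : α → Matrix κ' κ' ℂ) :
    (l.map f).prod ⊗ₖ (l.map g).prod = (l.map fun m => f m ⊗ₖ g m).prod := by
  induction l with
  | nil => simp
  | cons a l ih => simp [← ih, Matrix.mul_kronecker_mul]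

def mixA {n d : ℕ} (A : Finset (Fin n)) (f g : Fin n → Fin d) : Fin n → Fin d :=
  fun i => if i ∈ A then f i else g i

def mergeEquiv {n d : ℕ} (A : Finset (Fin n)) :
    (((i : A) → Fin d) × ((i : (Aᶜ : Finset (Fin n))) → Fin d)) ≃ (Fin n → Fin d) where
  toFun p := mergeCfg A p.1 p.2
  invFun f := (fun i => f i, fun i => f i)
  left_inv := by
    rintro ⟨x, z⟩
    ext i
    · simp [mergeCfg]
    · have := Finset.mem_compl.1 i.2
      simp [mergeCfg, this]
  right_inv := by
    intro f; ext i; simp [mergeCfg]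

theorem mix_merge {n d : ℕ} (A : Finset (Fin n)) (x y : (i : A) → Fin d)
    (z w : (i : (Aᶜ : Finset (Fin n))) → Fin d) :
    mixA A (mergeCfg A x z) (mergeCfg A y w) = mergeCfg A x w := by
  ext i; by_cases h : i ∈ A <;> simp [mixA, mergeCfg, h]

theorem purity_expand {n d : ℕ} (A : Finset (Fin n)) (ψ : (Fin n → Fin d) → ℂ) :
    (rhoA A ψ * rhoA A ψ).trace = ∑ f, ∑ g,
      ψ f * ψ g * conj (ψ (mixA A g f)) * conj (ψ (mixA A f g)) := by
  rw [← Equiv.sum_comp (mergeEquiv A), Fintype.sum_prod_type]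
  simp_rw [← Equiv.sum_comp (mergeEquiv A) (fun g => ψ _ * ψ g * conj (ψ (mixA A g _)) * conj (ψ (mixA A _ g))),
    Fintype.sum_prod_type]
  simp only [mergeEquiv, Equiv.coe_fn_mk, mix_merge]
  simp only [Matrix.trace, Matrix.diag_apply, Matrix.mul_apply, rhoA, Matrix.of_apply]
  refine Finset.sum_congr rfl fun x _ => ?_
  rw [Finset.sum_comm]
  refine Finset.sum_congr rfl fun y _ => ?_
  rw [Finset.sum_mul_sum]
  refine Finset.sum_congr rfl fun z _ => Finset.sum_congr rfl fun w _ => ?_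
  ring

/-- conjugated site matrix -/
def siteC (d D : ℕ) [NeZero d] (U : Matrix.unitaryGroup (Fin d × Fin D) ℂ) (i : Fin d) :
    Matrix (Fin D) (Fin D) ℂ := (starRingEnd ℂ).mapMatrix (siteMat d D U i)

def site4 (d D : ℕ) [NeZero d] (sw : Prop) [Decidable sw] (U : Matrix.unitaryGroup (Fin d × Fin D) ℂ)
   (s : Fin d × Fin d) : Matrix (Fin D × Fin D × Fin D × Fin D) (Fin D × Fin D × Fin D × Fin D) ℂ :=
  siteMat d D U s.1 ⊗ₖ (siteMat d D U s.2 ⊗ₖ (siteC d D U (if sw then s.2 else s.1) ⊗ₖ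
    siteC d D U (if sw then s.1 else s.2)))

theorem conj_mps (d D n : ℕ) [NeZero d] (U : Fin n → Matrix.unitaryGroup (Fin d × Fin D) ℂ)
    (f : Fin n → Fin d) : conj (mps d D n U f) =
      Matrix.trace (((List.finRange n).map fun m => siteC d D (U m) (f m)).prod) := by
  have : ((List.finRange n).map fun m => siteC d D (U m) (f m)).prod = 
     (starRingEnd ℂ).mapMatrix (((List.finRange n).map fun m => siteMat d D (U m) (f m)).prod) := by
    rw [map_list_prod, List.map_map]; rfl
  rw [this, mps, Matrix.trace, Matrix.trace, map_sum]
  rfl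

theorem purity_trace (d D n : ℕ) [NeZero d] (U : Fin n → Matrix.unitaryGroup (Fin d × Fin D) ℂ)
    (A : Finset (Fin n)) :
    (rhoA A (mps d D n U) * rhoA A (mps d D n U)).trace =
      (((List.finRange n).map fun m => ∑ s, site4 d D (m ∈ A) (U m) s).prod).trace := by
  rw [purity_expand, ← sum_prod_list, Matrix.trace_sum,
    ← Equiv.sum_comp (Equiv.arrowProdEquivProdArrow (Fin n) (fun _ => Fin d) (fun _ => Fin d)).symm,
    Fintype.sum_prod_type]
  refine Finset.sum_congr rfl fun f _ => Finset.sum_congr rfl fun g _ => ?_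
  simp only [site4]
  rw [← kron_list, ← kron_list, ← kron_list, Matrix.trace_kronecker, Matrix.trace_kronecker,
    Matrix.trace_kronecker, conj_mps, conj_mps]
  simp only [mps, mul_assoc]
  rfl

def PP (D : ℕ) : Matrix (Fin D × Fin D × Fin D × Fin D) (Fin 2) ℂ := Matrix.of fun a s =>
  if s = 0 then (if a.1 = a.2.2.1 ∧ a.2.1 = a.2.2.2 then 1 else 0)
  else (if a.1 = a.2.2.2 ∧ a.2.1 = a.2.2.1 then 1 else 0)

def KK (d D : ℕ) (sw : Prop) [Decidable sw] : Matrix (Fin 2) (Fin 2) ℂ :=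
  (((d * D : ℂ)^2 - 1) * (d * D))⁻¹ •
  (if sw then !![d * (d * D : ℂ), -d; -d^2, d^2 * (d * D)] else !![d^2 * (d * D : ℂ), -d^2; -d, d * (d * D)])

theorem site4_int (d D : ℕ) [NeZero d] (sw : Prop) [Decidable sw]
    (μ : Measure (Matrix.unitaryGroup (Fin d × Fin D) ℂ)) [IsProbabilityMeasure μ]
    (a b : Fin D × Fin D × Fin D × Fin D) (s : Fin d × Fin d) :
    Integrable (fun U => site4 d D sw U s a b) μ := by
  have := integrable_mono μ ((0 : Fin d), b.1) (0, b.2.1) (0, b.2.2.1) (0, b.2.2.2)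
    (s.1, a.1) (s.2, a.2.1) ((if sw then s.2 else s.1), a.2.2.1) ((if sw then s.1 else s.2), a.2.2.2)
  refine this.congr (Filter.Eventually.of_forall fun U => ?_)
  simp [site4, Matrix.kroneckerMap_apply, siteMat, siteC, mul_assoc]

theorem mean_site (d D : ℕ) [NeZero d] (hd : 2 ≤ d) (hD : 2 ≤ D) (sw : Prop) [Decidable sw]
    (μ : Measure (Matrix.unitaryGroup (Fin d × Fin D) ℂ)) [IsProbabilityMeasure μ]
    (hH : ∀ V : Matrix.unitaryGroup (Fin d × Fin D) ℂ, μ.map (fun U => V * U) = μ) :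
    (Matrix.of fun a b => ∫ U, (∑ s, site4 d D sw U s) a b ∂μ) = PP D * KK d D sw * (PP D)ᵀ := by
  ext a b
  simp only [Matrix.of_apply, Matrix.sum_apply]
  rw [integral_finsetSum _ fun s _ => site4_int d D sw μ a b s]
  have hq : ((d * D : ℂ)^2 - 1) * (d * D) ≠ 0 := by
    have h : (4:ℝ) ≤ d * D := by exact_mod_cast Nat.mul_le_mul hd hD
    have : (((d * D : ℝ)^2 - 1) * (d * D)) ≠ 0 := by
      apply mul_ne_zero <;> nlinarith
    exact_mod_cast this
  have hc : Fintype.card (Fin d × Fin D) = d * D := by simp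
  have e : ∀ s, ∫ U, site4 d D sw U s a b ∂μ = FF μ ((0 : Fin d), b.1) (0, b.2.1) (0, b.2.2.1) (0, b.2.2.2)
    (s.1, a.1) (s.2, a.2.1) ((if sw then s.2 else s.1), a.2.2.1) ((if sw then s.1 else s.2), a.2.2.2) := by
    intro s
    refine integral_congr_ae (Filter.Eventually.of_forall fun U => ?_)
    simp [site4, Matrix.kroneckerMap_apply, siteMat, siteC, mul_assoc]
  simp only [e]
  have w := FF_wg μ hH (by rw [hc]; nlinarith) ((0 : Fin d), b.1) (0, b.2.1) (0, b.2.2.1) (0, b.2.2.2)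
  rw [hc] at w
  push_cast at w
  have w' := fun r1 r2 r3 r4 => (eq_div_of_mul_eq hq ((mul_comm _ _).trans (w r1 r2 r3 r4)))
  simp only [w', Prod.mk.injEq, true_and]
  rw [← Finset.sum_div, div_eq_inv_mul]
  simp only [KK, Matrix.mul_smul, Matrix.smul_mul, Matrix.smul_apply, smul_eq_mul]
  congr 1
  rw [Finset.sum_add_distrib, ← Finset.mul_sum, ← Finset.mul_sum, Fintype.sum_prod_type,
    Fintype.sum_prod_type]
  obtain ⟨a1, a2, a3, a4⟩ := a
  obtain ⟨b1, b2, b3, b4⟩ := b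
  have i1 : ∀ (x y : Fin d) (p : Prop) (q : Prop) [Decidable p] [Decidable q], (if (x = y ∧ p) ∧ y = x ∧ q then (1:ℂ) else 0) =
     (if x = y then (if p ∧ q then 1 else 0) else 0) := by
    intro x y p q _ _
    by_cases h : x = y <;> simp [h]
  clear w' w e
  by_cases hs : sw
  · simp only [hs, if_true, i1, true_and]
    simp [Matrix.mul_apply, Fin.sum_univ_two, PP, -Finset.sum_boole]
    split_ifs <;> ring
  · simp only [hs, if_false, i1, true_and]
    simp [Matrix.mul_apply, Fin.sum_univ_two, PP, -Finset.sum_boole]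
    split_ifs <;> ring

def TT (a b : ℝ) (sw : Prop) [Decidable sw] : Matrix (Fin 2) (Fin 2) ℝ :=
  if sw then !![a, b; 0, 1] else !![1, 0; b, a]

theorem gramPP (D : ℕ) : (PP D)ᵀ * PP D = !![(D:ℂ)^2, D; D, D^2] := by
  have i0 : ∀ (x y : Fin D) (p : Prop) [Decidable p], (if x = y ∧ p then (1:ℂ) else 0) =
     (if x = y then (if p then 1 else 0) else 0) := by
    intro x y p _
    by_cases h : x = y <;> simp [h]
  ext i j
  simp only [Matrix.mul_apply, Matrix.transpose_apply, Fintype.sum_prod_type]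
  fin_cases i <;> fin_cases j <;>
  simp [PP, i0, -Finset.sum_boole, ite_mul, mul_ite, sq]

theorem TT_eq (d D : ℕ) (hd : 2 ≤ d) (hD : 2 ≤ D) (sw : Prop) [Decidable sw] :
    (PP D)ᵀ * PP D * KK d D sw =
      Complex.ofRealHom.mapMatrix (TT (etaF d D) (etaF D d) sw) := by
  have h4 : (4:ℝ) ≤ d * D := by exact_mod_cast Nat.mul_le_mul hd hD
  have hd0 : (d:ℂ) ≠ 0 := by norm_cast; omega
  have hD0 : (D:ℂ) ≠ 0 := by norm_cast; omega
  have hq : ((d * D : ℂ)^2 - 1) ≠ 0 := by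
    have : ((d * D : ℝ)^2 - 1) ≠ 0 := by nlinarith
    exact_mod_cast this
  have hq1 : ((d : ℂ)^2 * D^2 - 1) ≠ 0 := by rwa [← mul_pow]
  have hq2 : ((D : ℂ)^2 * d^2 - 1) ≠ 0 := by rwa [mul_comm]
  rw [gramPP]
  ext i j
  by_cases hs : sw
  · fin_cases i <;> fin_cases j <;> 
    simp [KK, TT, hs, etaF, Matrix.mul_apply, Fin.sum_univ_two] <;> field_simp <;> ring
  · fin_cases i <;> fin_cases j <;> 
    simp [KK, TT, hs, etaF, Matrix.mul_apply, Fin.sum_univ_two] <;> field_simp <;> ring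

theorem conj_list {α κ κ' : Type} [Fintype κ] [DecidableEq κ] [Fintype κ'] [DecidableEq κ']
    (P : Matrix κ κ' ℂ) (Q : Matrix κ' κ ℂ) (K : α → Matrix κ' κ' ℂ) (l : List α) :
    Q * (l.map fun m => P * K m * Q).prod = (l.map fun m => Q * P * K m).prod * Q := by
  induction l with
  | nil => simp
  | cons a l ih =>
    simp only [List.map_cons, List.prod_cons, Matrix.mul_assoc] at ih ⊢
    rw [ih]

theorem trace_list {α κ κ' : Type} [Fintype κ] [DecidableEq κ] [Fintype κ'] [DecidableEq κ']
    (P : Matrix κ κ' ℂ) (Q : Matrix κ' κ ℂ) (K : α → Matrix κ' κ' ℂ) (l : List α) (hl : l ≠ []) :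
    ((l.map fun m => P * K m * Q).prod).trace = ((l.map fun m => Q * P * K m).prod).trace := by
  cases l with
  | nil => exact absurd rfl hl
  | cons a l =>
    rw [List.map_cons, List.prod_cons, List.map_cons, List.prod_cons, Matrix.mul_assoc, conj_list,
      ← Matrix.mul_assoc, Matrix.trace_mul_comm, ← Matrix.mul_assoc, ← Matrix.mul_assoc]

theorem comb_list {R : Type} [Monoid R] (k m : ℕ) (hk : 1 ≤ k) (S T : R) :
    ((List.range (k * m)).map fun i => if k ∣ i + 1 then S else T).prod = (T ^ (k - 1) * S) ^ m := by
  induction m with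
  | zero => simp
  | succ m ih =>
    rw [Nat.mul_succ, List.range_add, List.map_append, List.prod_append, ih, pow_succ, List.map_map]
    congr 1
    obtain ⟨j, rfl⟩ : ∃ j, k = j + 1 := ⟨k - 1, by omega⟩
    rw [List.range_succ, List.map_append, List.prod_append]
    congr 1
    · rw [List.prod_eq_pow_card _ T]
      · simp
      · intro x hx
        simp only [List.mem_map, List.mem_range, Function.comp] at hx
        obtain ⟨i, hi, rfl⟩ := hx
        rw [if_neg]
        rw [add_assoc, Nat.dvd_add_right (Nat.dvd_mul_right _ _)]
        exact Nat.not_dvd_of_pos_of_lt (by omega) (by omega)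
    · simp only [List.map_cons, List.map_nil, List.prod_singleton, Function.comp]
      rw [if_pos]
      rw [add_assoc]
      exact Nat.dvd_add (Nat.dvd_mul_right _ _) dvd_rfl

theorem TT_pow (a b : ℝ) (j : ℕ) : (!![1, 0; b, a] : Matrix (Fin 2) (Fin 2) ℝ) ^ j =
    !![1, 0; b * ∑ i ∈ Finset.range j, a ^ i, a ^ j] := by
  induction j with
  | zero => ext i j; fin_cases i <;> fin_cases j <;> simp
  | succ j ih =>
    rw [pow_succ', ih, Matrix.mul_fin_two, Finset.sum_range_succ']
    ext i j; fin_cases i <;> fin_cases j <;> simp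
    · rw [mul_left_comm, Finset.mul_sum]; simp only [pow_succ']; ring
    · ring

theorem trace_pow_le (p q r s : ℝ) (hp : 0 ≤ p) (hq : 0 ≤ q) (hr : 0 ≤ r) (hs : 0 ≤ s)
    (hdet : 0 ≤ p * s - q * r) (m : ℕ) :
    ((!![p, q; r, s] : Matrix (Fin 2) (Fin 2) ℝ) ^ (m + 1)).trace ≤ (p + s) ^ (m + 1) := by
  set M : Matrix (Fin 2) (Fin 2) ℝ := !![p, q; r, s] with hM
  have hM0 : ∀ i j, 0 ≤ M i j := by intro i j; fin_cases i <;> fin_cases j <;> simpa [hM]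
  have hpos : ∀ m i j, 0 ≤ (M ^ m) i j := by
    intro m
    induction m with
    | zero => intro i j; rw [pow_zero, Matrix.one_apply]; split_ifs <;> norm_num
    | succ m ih => intro i j; rw [pow_succ, Matrix.mul_apply]
                   exact Finset.sum_nonneg fun k _ => mul_nonneg (ih _ _) (hM0 _ _)
  have hCH : M * M = (p + s) • M - (p * s - q * r) • (1 : Matrix (Fin 2) (Fin 2) ℝ) := by
    rw [hM]
    ext i j; fin_cases i <;> fin_cases j <;> simp <;> ring
  induction m with
  | zero => simp [hM, Matrix.trace_fin_two]
  | succ m ih =>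
    have h : M ^ (m + 1 + 1) = (p + s) • M ^ (m + 1) - (p * s - q * r) • M ^ m := by
      rw [pow_succ, pow_succ, mul_assoc, hCH, mul_sub, mul_smul_comm, mul_smul_comm, mul_one]
    rw [h, Matrix.trace_sub, Matrix.trace_smul, Matrix.trace_smul, smul_eq_mul, smul_eq_mul]
    have ht : 0 ≤ (M ^ m).trace := Finset.sum_nonneg fun i _ => hpos m i i
    have := mul_le_mul_of_nonneg_left ih (add_nonneg hp hs)
    have := mul_nonneg hdet ht
    rw [pow_succ (p + s) (m + 1)]
    linarith

theorem final_ineq (a b : ℝ) (ha : 0 ≤ a) (hb : 0 ≤ b) (hab : a + b ≤ 1) (k m : ℕ) (hm : 1 ≤ m) :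
    (((!![1, 0; b, a] : Matrix (Fin 2) (Fin 2) ℝ) ^ (k - 1) * !![a, b; 0, 1]) ^ m).trace ≤
      (a ^ (k - 1) + b + a) ^ m := by
  obtain ⟨m, rfl⟩ : ∃ j, m = j + 1 := ⟨m - 1, by omega⟩
  generalize k - 1 = j
  set g := ∑ i ∈ Finset.range j, a ^ i with hg
  have hg0 : 0 ≤ g := Finset.sum_nonneg fun i _ => pow_nonneg ha _
  have hgg : g * (1 - a) = 1 - a ^ j := by rw [hg]; exact geom_sum_mul_neg a j
  have hj : 0 ≤ a ^ j := pow_nonneg ha _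
  have hbg : b * g ≤ 1 := by nlinarith
  have hbg0 : 0 ≤ b * g := mul_nonneg hb hg0
  have e : (!![1, 0; b, a] : Matrix (Fin 2) (Fin 2) ℝ) ^ j * !![a, b; 0, 1] =
      !![a, b; b * g * a, b * g * b + a ^ j] := by
    rw [TT_pow, Matrix.mul_fin_two]
    ext i j; fin_cases i <;> fin_cases j <;> simp [hg]
  rw [e]
  refine (trace_pow_le _ _ _ _ ha hb (by positivity) (by positivity) ?_ m).trans ?_
  · have := mul_nonneg ha hj
    nlinarith
  · refine pow_le_pow_left₀ (by positivity) ?_ _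
    nlinarith
end
theorem etaF_nonneg (d D : ℕ) (hd : 2 ≤ d) (hD : 2 ≤ D) : 0 ≤ etaF d D := by
  have h1 : (2:ℝ) ≤ d := by exact_mod_cast hd
  have h2 : (2:ℝ) ≤ D := by exact_mod_cast hD
  have h4 : (4:ℝ) ≤ d * D := by nlinarith
  unfold etaF
  apply div_nonneg
  · nlinarith [mul_nonneg (by linarith : (0:ℝ) ≤ d) (by nlinarith : (0:ℝ) ≤ (D:ℝ)^2 - 1)]
  · rw [← mul_pow]; nlinarith

theorem etaF_add (d D : ℕ) (hd : 2 ≤ d) (hD : 2 ≤ D) : etaF d D + etaF D d ≤ 1 := by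
  have h1 : (2:ℝ) ≤ d := by exact_mod_cast hd
  have h2 : (2:ℝ) ≤ D := by exact_mod_cast hD
  have h4 : (4:ℝ) ≤ d * D := by nlinarith
  unfold etaF
  rw [show (D:ℝ)^2 * d^2 - 1 = d^2 * D^2 - 1 by ring, ← add_div, div_le_one]
  · have : 0 ≤ ((d:ℝ) * D - 1) * (((d:ℝ) - 1) * (D - 1)) :=
      mul_nonneg (by linarith) (mul_nonneg (by linarith) (by linarith))
    nlinarith
  · rw [← mul_pow]; nlinarith

/-- expected purity of the comb subsystem.  Let `k ≥ 2` divide `n` and let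
`A = {k, 2k, …, n}` consist of every `k`-th site (in 0-based labels: the sites `i` with
`k ∣ i+1`).  Then `E Tr[ρ_A²] ≤ (η(d,D)^{k−1} + η(D,d) + η(d,D))^{n/k}`, with the site
unitaries drawn i.i.d. from the Haar probability measure on `U(dD)` (the unique
left-invariant Borel probability measure). The inequality is stated in the complex order,
the right-hand side being a real scalar. -/
theorem expected_purity_comb
    (d D n k : ℕ) [NeZero d] (hd : 2 ≤ d) (hD : 2 ≤ D) (hk : 2 ≤ k) (hn : 1 ≤ n)
    (hdvd : k ∣ n)
    (μ : Measure (Matrix.unitaryGroup (Fin d × Fin D) ℂ)) [IsProbabilityMeasure μ]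
    (hHaar : ∀ V : Matrix.unitaryGroup (Fin d × Fin D) ℂ, μ.map (fun U => V * U) = μ) :
    ∫ U, Matrix.trace
        (rhoA (Finset.univ.filter fun i : Fin n => k ∣ ((i : ℕ) + 1)) (mps d D n U) *
          rhoA (Finset.univ.filter fun i : Fin n => k ∣ ((i : ℕ) + 1)) (mps d D n U))
        ∂(Measure.pi fun _ : Fin n => μ)
      ≤ (((etaF d D ^ (k - 1) + etaF D d + etaF d D) ^ (n / k) : ℝ) : ℂ) := by
  obtain ⟨m, rfl⟩ := hdvd
  have hm : 1 ≤ m := by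
    rcases Nat.eq_zero_or_pos m with h | h
    · simp [h] at hn
    · exact h
  simp_rw [purity_trace]
  rw [int_prod_list μ (k * m) (fun m U => ∑ s, site4 d D
    (m ∈ Finset.univ.filter fun i : Fin _ => k ∣ ((i : ℕ) + 1)) U s)]
  · simp_rw [mean_site d D hd hD _ μ hHaar]
    rw [trace_list]
    · simp_rw [TT_eq d D hd hD]
      have e : ((List.finRange (k * m)).map fun x : Fin (k * m) => Complex.ofRealHom.mapMatrix
          (TT (etaF d D) (etaF D d) (x ∈ Finset.univ.filter fun i : Fin _ => k ∣ ((i : ℕ) + 1)))).prod =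
          Complex.ofRealHom.mapMatrix
            (((!![1, 0; etaF D d, etaF d D] : Matrix (Fin 2) (Fin 2) ℝ) ^ (k - 1) *
              !![etaF d D, etaF D d; 0, 1]) ^ m) := by
        rw [← comb_list k m (by omega), map_list_prod, ← List.map_coe_finRange_eq_range,
          List.map_map, List.map_map]
        congr 1
        refine List.map_congr_left fun x _ => ?_
        simp [TT]
      rw [e]
      have t : ∀ M : Matrix (Fin 2) (Fin 2) ℝ, (Complex.ofRealHom.mapMatrix M).trace = (M.trace : ℂ) := by
        intro M; simp [Matrix.trace_fin_two]
      rw [t, Nat.mul_div_cancel_left m (by omega)]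
      exact_mod_cast final_ineq _ _ (etaF_nonneg d D hd hD) (etaF_nonneg D d hD hd)
        (etaF_add d D hd hD) k m hm
    · intro h
      have := congrArg List.length h
      simp at this
      omega
  · intro x i j
    simp_rw [Matrix.sum_apply]
    exact integrable_finsetSum _ fun s _ => site4_int d D _ μ i j s
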